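/- Let A be a finite alphabet, K a positive integer, and x ∈ A^ℤ a linearly recurrent sequence with constant K which is aperiodic (there is no integer T ≥ 1 with x_{i+T} = x_i for all i ∈ ℤ). Then there exists a constant K̄ (depending only on K) such that for every shift-invariant Borel probability measure μ on the subshift Ω(x), every finite word w occurring in x, and every y ∈ Ω(x), μ([w]) · N_{[w]}^{(1)}(y) ≤ K̄. -/

import Mathlib

open Function MeasureTheory

/-- The shift map on `A^ℤ`: `(σ y) i = y (i+1)`. -/
def shiftMap {A : Type*} (y : ℤ → A) : ℤ → A := fun i => y (i + 1)

/-- The word `w` occurs in `y` at position `i`. -/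
def OccursAt {A : Type*} (w : List A) (y : ℤ → A) (i : ℤ) : Prop :=
  ∀ j : Fin w.length, y (i + (j : ℕ)) = w.get j

/-- The word `w` occurs in (is a factor of) the sequence `y`. -/
def OccursIn {A : Type*} (w : List A) (y : ℤ → A) : Prop :=
  ∃ i : ℤ, OccursAt w y i

/-- `x` is linearly recurrent with constant `K`: every factor of `x` of length
`K·|w|` contains an occurrence of every word `w` occurring in `x`. -/
def LinearlyRecurrent {A : Type*} (K : ℕ) (x : ℤ → A) : Prop :=
  ∀ w : List A, OccursIn w x → ∀ i : ℤ,
    ∃ j : ℕ, j + w.length ≤ K * w.length ∧ OccursAt w x (i + (j : ℕ))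

/-- The subshift generated by `x`: all bi-infinite sequences whose factors are
factors of `x`. -/
def subshiftOf {A : Type*} (x : ℤ → A) : Set (ℤ → A) :=
  {y : ℤ → A | ∀ w : List A, OccursIn w y → OccursIn w x}

/-- The cylinder set `[w]` in the subshift generated by `x`. -/
def cylinderIn {A : Type*} (x : ℤ → A) (w : List A) : Set (ℤ → A) :=
  {y : ℤ → A | y ∈ subshiftOf x ∧ OccursAt w y 0}

/-- The entrance time `N_I^{(1)}(y) = inf {n ≥ 1 : σ^n y ∈ I}` (with the convention
`sInf ∅ = 0` in `ℕ`). -/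
noncomputable def entranceTime {X : Type*} (T : X → X) (I : Set X) (y : X) : ℕ :=
  sInf {n : ℕ | 1 ≤ n ∧ T^[n] y ∈ I}

theorem shiftMap_iterate_apply {A : Type*} (y : ℤ → A) (p : ℕ) (i : ℤ) :
    shiftMap^[p] y i = y (i + p) := by
  induction p generalizing i with
  | zero => simp
  | succ p ih =>
    rw [iterate_succ_apply', shiftMap, ih]
    push_cast
    congr 1
    ring

theorem occursAt_shiftMap_iterate {A : Type*} (w : List A) (y : ℤ → A) (p : ℕ) (i : ℤ) :
    OccursAt w (shiftMap^[p] y) i ↔ OccursAt w y (i + p) := by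
  simp only [OccursAt, shiftMap_iterate_apply, add_right_comm]

theorem shiftMap_iterate_mem_subshiftOf {A : Type*} {x y : ℤ → A} (hy : y ∈ subshiftOf x)
    (p : ℕ) : shiftMap^[p] y ∈ subshiftOf x := by
  rintro w ⟨i, hi⟩
  exact hy w ⟨i + p, (occursAt_shiftMap_iterate w y p i).1 hi⟩

/-- The factor of `y` of length `n` starting at position `i` occurs there. -/
theorem occursAt_ofFn {A : Type*} (y : ℤ → A) (i : ℤ) (n : ℕ) :
    OccursAt (List.ofFn fun j : Fin n => y (i + (j : ℕ))) y i := by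
  intro j
  simp

/-- If `y` and `x` agree on a window of length `n`, words inside the window transfer. -/
theorem OccursAt.transfer {A : Type*} {w : List A} {x y : ℤ → A} {a b : ℤ} {n j : ℕ}
    (hxy : OccursAt (List.ofFn fun k : Fin n => y (b + (k : ℕ))) x a)
    (hj : j + w.length ≤ n) (hw : OccursAt w x (a + j)) : OccursAt w y (b + j) := by
  intro k
  have hk := k.isLt
  have h := hxy ⟨j + k, by simp; omega⟩
  simp only [List.get_eq_getElem, List.getElem_ofFn, Nat.cast_add, ← add_assoc] at h
  rw [← h]
  exact hw k

theorem LinearlyRecurrent.entranceTime_le {A : Type*} {K : ℕ} {x y : ℤ → A}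
    (hx : LinearlyRecurrent K x) {w : List A} (hw : OccursIn w x) (hy : y ∈ subshiftOf x) :
    entranceTime shiftMap (cylinderIn x w) y ≤ K * w.length + 1 - w.length := by
  obtain ⟨a, ha⟩ := hy _ ⟨1, occursAt_ofFn y 1 (K * w.length)⟩
  obtain ⟨j, hj, hj'⟩ := hx w hw a
  have hocc := ha.transfer hj hj'
  rw [add_comm, ← zero_add ((j : ℤ) + 1), ← Nat.cast_one, ← Nat.cast_add,
    ← occursAt_shiftMap_iterate] at hocc
  have hmem : shiftMap^[j + 1] y ∈ cylinderIn x w :=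
    ⟨shiftMap_iterate_mem_subshiftOf hy _, hocc⟩
  have hle : entranceTime shiftMap (cylinderIn x w) y ≤ j + 1 :=
    Nat.sInf_le ⟨Nat.le_add_left 1 j, hmem⟩
  omega

/-- A word which reappears quickly is periodic, and linear recurrence then forces `x` to be
periodic. -/
theorem LinearlyRecurrent.periodic_of_occursAt {A : Type*} {K : ℕ} {x y : ℤ → A}
    (hx : LinearlyRecurrent K x) {w : List A} (hw : OccursIn w x) {p : ℕ}
    (hp : K * (p + 1) ≤ w.length) (h0 : OccursAt w y 0) (h1 : OccursAt w y p) (i : ℤ) :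
    x (i + p) = x i := by
  obtain ⟨a, ha⟩ := hw
  obtain ⟨j, hj, hu⟩ := hx _ ⟨i, occursAt_ofFn x i (p + 1)⟩ a
  simp only [List.length_ofFn] at hj
  have hfirst := hu ⟨0, by simp⟩
  have hlast := hu ⟨p, by simp⟩
  simp only [List.get_eq_getElem, List.getElem_ofFn, Nat.cast_zero, add_zero] at hfirst hlast
  rw [← hfirst, ← hlast, add_assoc, ← Nat.cast_add, ha ⟨j, by omega⟩, ha ⟨j + p, by omega⟩,
    ← h0 ⟨j + p, by omega⟩, ← h1 ⟨j, by omega⟩]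
  congr 1
  push_cast
  ring

theorem measurable_shiftMap {A : Type*} [MeasurableSpace A] :
    Measurable (shiftMap : (ℤ → A) → ℤ → A) :=
  measurable_pi_lambda _ fun i => measurable_pi_apply (i + 1)

theorem measurableSet_occursAt {A : Type*} [MeasurableSpace A] [DiscreteMeasurableSpace A]
    (w : List A) (i : ℤ) : MeasurableSet {y : ℤ → A | OccursAt w y i} := by
  simp only [OccursAt, Set.ofPred_forall]
  refine .iInter fun j => ?_
  have h : MeasurableSet ((fun y : ℤ → A => y (i + (j : ℕ))) ⁻¹' {w.get j}) :=
    measurable_pi_apply _ .of_discrete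
  exact h

theorem measurableSet_cylinderIn {A : Type*} [Countable A] [MeasurableSpace A]
    [DiscreteMeasurableSpace A] (x : ℤ → A) (w : List A) :
    MeasurableSet (cylinderIn x w) := by
  have h : MeasurableSet (subshiftOf x) := by
    simp only [subshiftOf, OccursIn, Set.ofPred_forall]
    refine .iInter fun v => .imp ?_ (.const _)
    simp only [Set.ofPred_exists]
    exact .iUnion fun i => measurableSet_occursAt v i
  exact h.inter (measurableSet_occursAt w 0)

theorem LinearlyRecurrent.measure_cylinderIn_le {A : Type*} [Countable A] [MeasurableSpace A]
    [DiscreteMeasurableSpace A] {K : ℕ} {x : ℤ → A} (hx : LinearlyRecurrent K x)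
    (hap : ¬ ∃ T : ℕ, 1 ≤ T ∧ ∀ i : ℤ, x (i + (T : ℕ)) = x i)
    {μ : Measure (ℤ → A)} [IsProbabilityMeasure μ] (hμ : MeasurePreserving shiftMap μ μ)
    {w : List A} (hw : OccursIn w x) :
    ((w.length / K : ℕ) : ENNReal) * μ (cylinderIn x w) ≤ 1 := by
  by_contra! h
  obtain ⟨y, hy, p, hp, hpy⟩ := hμ.exists_mem_iterate_mem_of_measure_univ_lt_mul_measure
    (measurableSet_cylinderIn x w).nullMeasurableSet (by rwa [measure_univ])
  have h1 := (occursAt_shiftMap_iterate w y p 0).1 hpy.2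
  rw [zero_add] at h1
  exact hap ⟨p, hp.1, hx.periodic_of_occursAt hw
    ((Nat.mul_le_mul_left K hp.2).trans (Nat.mul_div_le _ _)) hy.2 h1⟩

/-- For every positive constant `K` there is a constant `K̄` (depending
only on `K`) such that for every finite alphabet `A`, every aperiodic linearly
recurrent sequence `x ∈ A^ℤ` with constant `K`, every shift-invariant Borel
probability measure `μ` on the subshift `Ω(x)`, every word `w` occurring in `x` and
every `y ∈ Ω(x)`, one has `μ([w]) · N_{[w]}^{(1)}(y) ≤ K̄`. -/
theorem stmt_13 (K : ℕ) (hK : 0 < K) :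
    ∃ Kbar : ℝ, ∀ (A : Type) [Fintype A] [MeasurableSpace A] [DiscreteMeasurableSpace A]
      (x : ℤ → A),
      LinearlyRecurrent K x →
      (¬ ∃ T : ℕ, 1 ≤ T ∧ ∀ i : ℤ, x (i + (T : ℕ)) = x i) →
      ∀ μ : Measure (ℤ → A), IsProbabilityMeasure μ →
        μ (subshiftOf x) = 1 →
        (∀ S : Set (ℤ → A), MeasurableSet S → μ (shiftMap ⁻¹' S) = μ S) →
        ∀ w : List A, OccursIn w x →
          ∀ y ∈ subshiftOf x,
            (μ (cylinderIn x w)).toReal *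
              (entranceTime shiftMap (cylinderIn x w) y : ℝ) ≤ Kbar := by
  refine ⟨2 * K ^ 2, ?_⟩
  intro A _ _ _ x hx hap μ _ _ hinv w hw y hy
  have hμ : MeasurePreserving shiftMap μ μ :=
    ⟨measurable_shiftMap, Measure.ext fun S hS => by
      rw [Measure.map_apply measurable_shiftMap hS, hinv S hS]⟩
  set m := (μ (cylinderIn x w)).toReal
  set N := entranceTime shiftMap (cylinderIn x w) y
  have hm0 : 0 ≤ m := ENNReal.toReal_nonneg
  have hm1 : m ≤ 1 := measureReal_le_one
  have hM : ((w.length / K : ℕ) : ℝ) * m ≤ 1 := by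
    simpa using ENNReal.toReal_mono ENNReal.one_ne_top (hx.measure_cylinderIn_le hap hμ hw)
  have hN : N ≤ K * (K * (w.length / K + 1)) := by
    have h1 : N ≤ _ := hx.entranceTime_le hw hy
    have h2 : w.length < K * (w.length / K + 1) := Nat.lt_mul_div_succ _ hK
    have h3 := Nat.mul_le_mul_left K (Nat.succ_le_of_lt h2)
    rw [Nat.mul_succ] at h3
    omega
  have hN' : (N : ℝ) ≤ K * (K * ((w.length / K : ℕ) + 1)) := by exact_mod_cast hN
  calc m * N ≤ m * (K * (K * ((w.length / K : ℕ) + 1))) := by gcongr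
    _ = K ^ 2 * ((w.length / K : ℕ) * m + m) := by ring
    _ ≤ K ^ 2 * (1 + 1) := by gcongr
    _ = 2 * K ^ 2 := by ring
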